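/- Let Γ be a finite connected non-complete graph of prime valency p that is 2-geodesic transitive but not 2-arc transitive. Then for every pair of adjacent vertices v,u, the stabiliser in Aut Γ of both v and u acts transitively on the set of common neighbours of v and u. -/

import Mathlib

open SimpleGraph

/-- `Γ` is arc transitive: its automorphism group is transitive on ordered pairs
of adjacent vertices. -/
def ArcTransitive {V : Type*} (Γ : SimpleGraph V) : Prop :=
  ∀ ⦃v u v' u' : V⦄, Γ.Adj v u → Γ.Adj v' u' →
    ∃ φ : Γ ≃g Γ, φ v = v' ∧ φ u = u'

/-- `(v,u,w)` is a 2-arc of `Γ`. -/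
def Is2Arc {V : Type*} (Γ : SimpleGraph V) (v u w : V) : Prop :=
  Γ.Adj v u ∧ Γ.Adj u w ∧ v ≠ w

/-- `(v,u,w)` is a 2-geodesic of `Γ`: a 2-arc with `v`, `w` non-adjacent. -/
def Is2Geodesic {V : Type*} (Γ : SimpleGraph V) (v u w : V) : Prop :=
  Γ.Adj v u ∧ Γ.Adj u w ∧ v ≠ w ∧ ¬ Γ.Adj v w

/-- `Γ` is 2-arc transitive: arc transitive and transitive on 2-arcs. -/
def TwoArcTransitive {V : Type*} (Γ : SimpleGraph V) : Prop :=
  ArcTransitive Γ ∧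
  ∀ ⦃v u w v' u' w' : V⦄, Is2Arc Γ v u w → Is2Arc Γ v' u' w' →
    ∃ φ : Γ ≃g Γ, φ v = v' ∧ φ u = u' ∧ φ w = w'

/-- `Γ` is 2-geodesic transitive: arc transitive and transitive on 2-geodesics. -/
def TwoGeodesicTransitive {V : Type*} (Γ : SimpleGraph V) : Prop :=
  ArcTransitive Γ ∧
  ∀ ⦃v u w v' u' w' : V⦄, Is2Geodesic Γ v u w → Is2Geodesic Γ v' u' w' →
    ∃ φ : Γ ≃g Γ, φ v = v' ∧ φ u = u' ∧ φ w = w'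

/-- The sum over `u ∈ U` of the differences `f (X + u) - f`. -/
noncomputable def shiftDiff {K : Type*} [Field K] (U : Finset K) (f : Polynomial K) :
    Polynomial K :=
  ∑ u ∈ U, (Polynomial.taylor u f - f)

section ShiftDiff

open Polynomial

variable {K : Type*} [Field K] {U : Finset K} {w : ℕ}

lemma sum_eval_sub_coeff_zero (hw : 1 ≤ w) (hP : ∀ s, 1 ≤ s → s < w → ∑ u ∈ U, u ^ s = 0)
    {g : K[X]} (hg : g.natDegree ≤ w) :
    ∑ u ∈ U, (g.eval u - g.coeff 0) = g.coeff w * ∑ u ∈ U, u ^ w := by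
  obtain ⟨w, rfl⟩ : ∃ k, w = k + 1 := ⟨w - 1, by omega⟩
  have h : ∀ u, g.eval u - g.coeff 0
      = (∑ i ∈ Finset.range w, g.coeff (i + 1) * u ^ (i + 1))
        + g.coeff (w + 1) * u ^ (w + 1) := by
    intro u
    rw [eval_eq_sum_range' (Nat.lt_succ_of_le hg), Finset.sum_range_succ,
      Finset.sum_range_succ']
    ring
  simp_rw [h, Finset.sum_add_distrib, Finset.mul_sum]
  rw [Finset.sum_comm, Finset.sum_eq_zero, zero_add]
  intro i hi
  rw [← Finset.mul_sum, hP _ (by omega) (by have := Finset.mem_range.1 hi; omega), mul_zero]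

lemma exists_power_sum_ne_zero (h0 : (0 : K) ∉ U) (hU : U.Nonempty) :
    ∃ s, 1 ≤ s ∧ s ≤ U.card ∧ ∑ u ∈ U, u ^ s ≠ 0 := by
  classical
  by_contra! hP
  obtain ⟨v, hv⟩ := hU
  set f : K[X] := X * ∏ a ∈ U.erase v, (X - C a) with hf
  have hdeg : f.natDegree ≤ U.card := by
    have h1 : (∏ a ∈ U.erase v, (X - C a)).natDegree = (U.erase v).card := by
      simp
    calc f.natDegree ≤ (X : K[X]).natDegree + (∏ a ∈ U.erase v, (X - C a)).natDegree :=
          natDegree_mul_le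
      _ = U.card := by
        rw [h1, natDegree_X, Finset.card_erase_of_mem hv]
        have := Finset.card_pos.2 ⟨v, hv⟩
        omega
  have hk : 1 ≤ U.card := Finset.card_pos.2 ⟨v, hv⟩
  have key := sum_eval_sub_coeff_zero hk (fun s h1 h2 => hP s h1 h2.le) hdeg
  rw [hP _ hk le_rfl, mul_zero, Finset.sum_eq_single_of_mem v hv] at key
  · have hc : f.coeff 0 = 0 := by simp [hf]
    rw [hc, sub_zero, hf, eval_mul, eval_X, eval_prod] at key
    rcases mul_eq_zero.1 key with h | h
    · exact h0 (h ▸ hv)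
    · obtain ⟨a, ha, h⟩ := Finset.prod_eq_zero_iff.1 h
      simp only [eval_sub, eval_X, eval_C] at h
      exact (Finset.mem_erase.1 ha).1 (sub_eq_zero.1 h).symm
  · intro b hb hbv
    have : eval b (∏ a ∈ U.erase v, (X - C a)) = 0 := by
      rw [eval_prod]
      exact Finset.prod_eq_zero (Finset.mem_erase.2 ⟨hbv, hb⟩) (by simp)
    simp [hf, this]

lemma coeff_shiftDiff (hw : 1 ≤ w) (hP : ∀ s, 1 ≤ s → s < w → ∑ u ∈ U, u ^ s = 0)
    {f : K[X]} {n : ℕ} (hn : f.natDegree ≤ n + w) :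
    (shiftDiff U f).coeff n
      = ((w + n).choose n : K) * f.coeff (w + n) * ∑ u ∈ U, u ^ w := by
  have hg : (hasseDeriv n f).natDegree ≤ w :=
    (natDegree_hasseDeriv_le f n).trans (by omega)
  have h := sum_eval_sub_coeff_zero hw hP hg
  rw [hasseDeriv_coeff, hasseDeriv_coeff] at h
  rw [← h, shiftDiff, finsetSum_coeff]
  refine Finset.sum_congr rfl fun u _ => ?_
  rw [coeff_sub, taylor_coeff]
  simp

lemma shiftDiff_eq_zero (hw : 1 ≤ w) (hP : ∀ s, 1 ≤ s → s < w → ∑ u ∈ U, u ^ s = 0)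
    {f : K[X]} (hf : f.natDegree < w) : shiftDiff U f = 0 := by
  ext n
  rw [coeff_shiftDiff hw hP (by omega), coeff_eq_zero_of_natDegree_lt (n := w + n) (by omega)]
  simp

lemma natDegree_shiftDiff {p : ℕ} [hp : Fact p.Prime] [CharP K p] (hw : 1 ≤ w)
    (hP : ∀ s, 1 ≤ s → s < w → ∑ u ∈ U, u ^ s = 0) (hPw : ∑ u ∈ U, u ^ w ≠ 0)
    {f : K[X]} (hf : w ≤ f.natDegree) (hfp : f.natDegree < p) :
    (shiftDiff U f).natDegree = f.natDegree - w ∧ shiftDiff U f ≠ 0 := by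
  have hne : (shiftDiff U f).coeff (f.natDegree - w) ≠ 0 := by
    rw [coeff_shiftDiff hw hP (by omega), Nat.add_sub_cancel' hf]
    refine mul_ne_zero (mul_ne_zero ?_ ?_) hPw
    · rw [Ne, CharP.cast_eq_zero_iff K p]
      intro h
      have h2 := Nat.choose_mul_factorial_mul_factorial (Nat.sub_le f.natDegree w)
      have h3 : p ∣ f.natDegree.factorial := by
        rw [← h2, mul_assoc]
        exact h.mul_right _
      exact absurd ((Nat.Prime.dvd_factorial hp.out).1 h3) (by omega)
    · have : f ≠ 0 := by
        rintro rfl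
        simp at hf
        omega
      simpa using this
  refine ⟨le_antisymm ?_ (le_natDegree_of_ne_zero hne), fun h => hne (by simp [h])⟩
  rw [natDegree_le_iff_coeff_eq_zero]
  intro n hn
  rw [coeff_shiftDiff hw hP (by omega), coeff_eq_zero_of_natDegree_lt (n := w + n) (by omega)]
  simp

lemma eval_shiftDiff (f : K[X]) (x : K) :
    (shiftDiff U f).eval x = ∑ u ∈ U, (f.eval (x + u) - f.eval x) := by
  simp [shiftDiff, eval_finsetSum, taylor_eval]

end ShiftDiff

section PrimeField

open Polynomial

variable {p : ℕ} [Fact p.Prime]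

lemma ZMod.eq_zero_of_eval_eq_zero {f : (ZMod p)[X]} (hf : f.natDegree < p)
    (h : ∀ x, f.eval x = 0) : f = 0 :=
  eq_zero_of_natDegree_lt_card_of_eval_eq_zero f Function.injective_id h (by simpa using hf)

lemma ZMod.exists_polynomial_eval_eq (g : ZMod p → ZMod p) :
    ∃ f : (ZMod p)[X], f.natDegree < p ∧ ∀ x, f.eval x = g x := by
  have hinj : Set.InjOn (id : ZMod p → ZMod p) (Finset.univ : Finset (ZMod p)) :=
    Function.injective_id.injOn
  refine ⟨Lagrange.interpolate Finset.univ id g, ?_,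
    fun x => Lagrange.eval_interpolate_at_node g hinj (Finset.mem_univ x)⟩
  have h := Lagrange.degree_interpolate_lt g hinj
  rw [Finset.card_univ, ZMod.card] at h
  by_cases h0 : Lagrange.interpolate Finset.univ id g = 0
  · rw [h0, natDegree_zero]
    exact (Fact.out : p.Prime).pos
  · exact (natDegree_lt_iff_degree_lt h0).2 h

lemma sum_shift_comp {A M : Type*} [AddCommGroup A] [AddCommGroup M] {U : Finset A}
    {π : Equiv.Perm A} (hπ : ∀ x y, π y - π x ∈ U ↔ y - x ∈ U) (g : A → M) (x : A) :
    ∑ u ∈ U, (g (π (x + u)) - g (π x)) = ∑ u ∈ U, (g (π x + u) - g (π x)) := by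
  refine Finset.sum_bij (fun u _ => π (x + u) - π x) ?_ ?_ ?_ ?_
  · intro u hu
    rw [hπ]
    simpa using hu
  · intro a _ b _ h
    simpa using h
  · intro b hb
    refine ⟨π.symm (π x + b) - x, ?_, by simp⟩
    rw [← hπ]
    simpa using hb
  · intro a _
    simp

/-- A permutation of the prime field preserving the relation `y - x ∈ U`, where `U` is a small
nonempty set of nonzero elements, is affine. -/
lemma exists_natDegree_le_one {U : Finset (ZMod p)} (h0 : 0 ∉ U) (hU : U.Nonempty)
    (hcard : 2 * U.card < p) {π : Equiv.Perm (ZMod p)}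
    (hπ : ∀ x y, π y - π x ∈ U ↔ y - x ∈ U) :
    ∃ f : (ZMod p)[X], f.natDegree ≤ 1 ∧ ∀ x, f.eval x = π x := by
  classical
  have hex : ∃ s, 1 ≤ s ∧ ∑ u ∈ U, u ^ s ≠ 0 := by
    obtain ⟨s, h1, -, h2⟩ := exists_power_sum_ne_zero h0 hU
    exact ⟨s, h1, h2⟩
  obtain ⟨w, hw, hwp, hP, hPw⟩ : ∃ w, 1 ≤ w ∧ 2 * w < p ∧
      (∀ s, 1 ≤ s → s < w → ∑ u ∈ U, u ^ s = 0) ∧ ∑ u ∈ U, u ^ w ≠ 0 := by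
    obtain ⟨h1, h2⟩ := Nat.find_spec hex
    refine ⟨Nat.find hex, h1, ?_, fun s hs hsw => ?_, h2⟩
    · obtain ⟨s, hs, hsU, hne⟩ := exists_power_sum_ne_zero h0 hU
      have := Nat.find_min' hex ⟨hs, hne⟩
      omega
    · by_contra hne
      exact Nat.find_min hex hsw ⟨hs, hne⟩
  obtain ⟨f, hfp, hf⟩ := ZMod.exists_polynomial_eval_eq π
  refine ⟨f, ?_, hf⟩
  by_contra! hf1
  have hlt : ∀ i, i < w → f.natDegree * i < p → f.natDegree * i < w := by
    intro i hi hip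
    by_contra! hge
    rw [mul_comm, ← natDegree_pow] at hip hge
    refine (natDegree_shiftDiff hw hP hPw hge hip).2
      (ZMod.eq_zero_of_eval_eq_zero ?_ fun x => ?_)
    · have := (natDegree_shiftDiff hw hP hPw hge hip).1
      omega
    · have h := sum_shift_comp hπ (fun y => (X ^ i : (ZMod p)[X]).eval y) x
      rw [← eval_shiftDiff, shiftDiff_eq_zero hw hP (by simpa using hi)] at h
      rw [eval_shiftDiff]
      simpa [hf] using h
  rcases hw.eq_or_lt with rfl | hw2
  · obtain ⟨hd, hne⟩ := natDegree_shiftDiff hw hP hPw hf1.le hfp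
    refine (natDegree_shiftDiff hw hP hPw (by omega) (by omega)).2
      (ZMod.eq_zero_of_eval_eq_zero (f := shiftDiff U (shiftDiff U f)) ?_ fun x => ?_)
    · have := (natDegree_shiftDiff hw hP hPw (f := shiftDiff U f) (by omega) (by omega)).1
      omega
    · have h : ∀ y, (shiftDiff U f).eval y = ∑ u ∈ U, u := by
        intro y
        rw [eval_shiftDiff]
        simpa [hf] using sum_shift_comp hπ (fun y => y) y
      simp [eval_shiftDiff (shiftDiff U f), h]
  · have hall : ∀ i, i < w → f.natDegree * i < w := by
      intro i
      induction i with
      | zero => intro h; simpa using h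
      | succ i ih =>
        intro h
        have h1 := ih (by omega)
        have h2 := hlt 1 (by omega) (by omega)
        refine hlt _ h ?_
        rw [mul_add]
        omega
    have := hall (w - 1) (by omega)
    have h3 : 2 * (w - 1) ≤ f.natDegree * (w - 1) := Nat.mul_le_mul_right _ hf1
    omega

lemma eq_one_of_two_fixed_points {U : Finset (ZMod p)} (h0 : 0 ∉ U) (hU : U.Nonempty)
    (hcard : 2 * U.card < p) {π : Equiv.Perm (ZMod p)}
    (hπ : ∀ x y, π y - π x ∈ U ↔ y - x ∈ U) {a b : ZMod p} (hab : a ≠ b)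
    (ha : π a = a) (hb : π b = b) : π = 1 := by
  obtain ⟨f, hf1, hf⟩ := exists_natDegree_le_one h0 hU hcard hπ
  have hX : f - X = 0 := by
    refine eq_zero_of_natDegree_lt_card_of_eval_eq_zero' (f - X) {a, b} ?_ ?_
    · simp [hf, ha, hb]
    · rw [Finset.card_pair hab]
      exact (natDegree_sub_le _ _).trans_lt (by simpa using by omega)
  ext x
  rw [← hf x, sub_eq_zero.1 hX]
  simp

end PrimeField

section PrimeDegree

variable {N : Type*} [Fintype N] {p : ℕ} [hp : Fact p.Prime]

/-- A transitive permutation group of prime degree contains a regular cyclic subgroup, so that its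
points can be labelled by `ZMod p` in such a way that translations belong to the group. -/
lemma exists_equiv_zmod (hN : Fintype.card N = p) {X : Subgroup (Equiv.Perm N)}
    (hX : ∀ x y, ∃ σ ∈ X, σ x = y) :
    ∃ e : ZMod p ≃ N, ∀ j, ∃ σ ∈ X, ∀ i, σ (e i) = e (i + j) := by
  classical
  obtain ⟨x₀⟩ : Nonempty N := Fintype.card_pos_iff.1 (hN ▸ hp.out.pos)
  have hdvd : p ∣ Nat.card X := by
    have horb : MulAction.orbit X x₀ = Set.univ := by
      ext y
      obtain ⟨σ, hσ, h⟩ := hX x₀ y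
      simpa using ⟨⟨σ, hσ⟩, h⟩
    have h := MulAction.index_stabilizer X x₀
    rw [horb, Set.ncard_univ, Nat.card_eq_fintype_card, hN] at h
    exact h ▸ Subgroup.index_dvd_card _
  obtain ⟨⟨σ, hσX⟩, hσ⟩ := exists_prime_orderOf_dvd_card' p hdvd
  rw [Subgroup.orderOf_mk] at hσ
  have hcyc : σ.IsCycle :=
    Equiv.Perm.isCycle_of_prime_order'' (hN ▸ hp.out) (hσ.trans hN.symm)
  have hmove : ∀ x, σ x ≠ x := by
    have hs : σ.support = Finset.univ := by
      rw [← Finset.card_eq_iff_eq_univ, ← hcyc.orderOf, hσ, hN]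
    intro x
    rw [← Equiv.Perm.mem_support, hs]
    exact Finset.mem_univ x
  have hmod : ∀ n : ℕ, σ ^ (n % p) = σ ^ n := fun n => by rw [← hσ, pow_mod_orderOf]
  have hadd : ∀ i j : ZMod p, (σ ^ j.val) ((σ ^ i.val) x₀) = (σ ^ (i + j).val) x₀ := by
    intro i j
    rw [ZMod.val_add, hmod, ← Equiv.Perm.mul_apply, ← pow_add, add_comm j.val]
  have hbij : Function.Bijective fun i : ZMod p => (σ ^ i.val) x₀ := by
    rw [Fintype.bijective_iff_surjective_and_card]
    refine ⟨fun y => ?_, by rw [ZMod.card, hN]⟩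
    obtain ⟨n, hn⟩ := hcyc.exists_pow_eq (hmove x₀) (hmove y)
    refine ⟨(n : ZMod p), ?_⟩
    simp only [ZMod.val_natCast, hmod, hn]
  exact ⟨Equiv.ofBijective _ hbij, fun j => ⟨σ ^ j.val, X.pow_mem hσX _, fun i => hadd i j⟩⟩

/-- Burnside: if a transitive permutation group of prime degree preserves a nontrivial relation,
then only its identity fixes two points. -/
lemma eq_one_of_fixes_two (hN : Fintype.card N = p) {X : Subgroup (Equiv.Perm N)}
    (hX : ∀ x y, ∃ σ ∈ X, σ x = y) {R : N → N → Prop}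
    (hR : ∀ σ ∈ X, ∀ x y, R (σ x) (σ y) ↔ R x y) (hirr : ∀ x, ¬ R x x)
    (hpos : ∃ x y, R x y) (hneg : ∃ x y, x ≠ y ∧ ¬ R x y)
    {σ : Equiv.Perm N} (hσ : σ ∈ X) {x y : N} (hxy : x ≠ y) (hx : σ x = x) (hy : σ y = y) :
    σ = 1 := by
  classical
  obtain ⟨e, he⟩ := exists_equiv_zmod hN hX
  let U : Finset (ZMod p) := Finset.univ.filter fun u => R (e 0) (e u)
  let W : Finset (ZMod p) := Finset.univ.filter fun u => u ≠ 0 ∧ ¬ R (e 0) (e u)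
  have hU : ∀ i j, j - i ∈ U ↔ R (e i) (e j) := by
    intro i j
    obtain ⟨τ, hτ, h⟩ := he i
    have := hR τ hτ (e 0) (e (j - i))
    simpa [U, h] using this.symm
  have hW : ∀ i j, j - i ∈ W ↔ i ≠ j ∧ ¬ R (e i) (e j) := by
    intro i j
    rw [← hU i j]
    simp [U, W, sub_eq_zero, eq_comm]
  let π : Equiv.Perm (ZMod p) := (e.trans σ).trans e.symm
  have hπ : ∀ i, e (π i) = σ (e i) := by simp [π]
  have hπU : ∀ i j, π j - π i ∈ U ↔ j - i ∈ U := by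
    intro i j
    rw [hU, hU, hπ, hπ, hR σ hσ]
  have hπW : ∀ i j, π j - π i ∈ W ↔ j - i ∈ W := by
    intro i j
    rw [hW, hW, hπ, hπ, hR σ hσ, π.injective.ne_iff]
  have hcard : U.card + W.card + 1 ≤ p := by
    have hd : Disjoint U W := by
      rw [Finset.disjoint_left]
      intro u hu hw
      exact (Finset.mem_filter.1 hw).2.2 (Finset.mem_filter.1 hu).2
    have h0 : (0 : ZMod p) ∉ U ∪ W := by simp [U, W, hirr]
    rw [← Finset.card_union_of_disjoint hd, ← Finset.card_insert_of_notMem h0]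
    exact (Finset.card_le_univ _).trans (ZMod.card p).le
  have hxy' : e.symm x ≠ e.symm y := e.symm.injective.ne hxy
  have hfx : π (e.symm x) = e.symm x := by simp [π, hx]
  have hfy : π (e.symm y) = e.symm y := by simp [π, hy]
  have hone : π = 1 := by
    by_cases hle : U.card ≤ W.card
    · refine eq_one_of_two_fixed_points (by simp [U, hirr]) ?_ (by omega) hπU hxy' hfx hfy
      obtain ⟨a, b, hab⟩ := hpos
      exact ⟨e.symm b - e.symm a, (hU _ _).2 (by simpa using hab)⟩
    · refine eq_one_of_two_fixed_points (by simp [W]) ?_ (by omega) hπW hxy' hfx hfy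
      obtain ⟨a, b, hab⟩ := hneg
      exact ⟨e.symm b - e.symm a, (hW _ _).2 (by simpa using hab)⟩
  ext z
  have := hπ (e.symm z)
  rw [hone] at this
  simpa using this.symm

/-- If the point stabiliser of a transitive group of prime degree has an orbit that is a nontrivial
suborbit of length at least a third of the degree, then the remaining points form an orbit. -/
lemma exists_fixing_map_eq (hN : Fintype.card N = p) {X : Subgroup (Equiv.Perm N)}
    (hX : ∀ x y, ∃ σ ∈ X, σ x = y) {R : N → N → Prop}
    (hR : ∀ σ ∈ X, ∀ x y, R (σ x) (σ y) ↔ R x y) (hirr : ∀ x, ¬ R x x) {x₀ t : N}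
    (ht : R x₀ t) (horb : ∀ y, R x₀ y → ∃ σ ∈ X, σ x₀ = x₀ ∧ σ t = y)
    (hk : p ≤ 3 * Nat.card {y // R x₀ y})
    {y z : N} (hy : y ≠ x₀) (hyR : ¬ R x₀ y) (hz : z ≠ x₀) (hzR : ¬ R x₀ z) :
    ∃ σ ∈ X, σ x₀ = x₀ ∧ σ y = z := by
  classical
  let S : Finset (Equiv.Perm N) := Finset.univ.filter fun σ => σ ∈ X ∧ σ x₀ = x₀
  have hS : ∀ σ, σ ∈ S ↔ σ ∈ X ∧ σ x₀ = x₀ := by simp [S]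
  have hcard : ∀ b, b ≠ x₀ → (S.image fun σ => σ b).card = S.card := by
    intro b hb
    refine Finset.card_image_of_injOn fun σ hσ τ hτ h => ?_
    rw [Finset.mem_coe, hS] at hσ hτ
    have h1 : τ⁻¹ * σ = 1 := by
      refine eq_one_of_fixes_two hN hX hR hirr ⟨x₀, t, ht⟩ ⟨x₀, y, hy.symm, hyR⟩
        (X.mul_mem (X.inv_mem hτ.1) hσ.1) hb ?_ ?_
      · simpa [Equiv.symm_apply_eq] using h
      · simp [Equiv.symm_apply_eq, hσ.2, hτ.2]
    exact (inv_mul_eq_one.1 h1).symm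
  let P : Finset N := Finset.univ.filter fun b => R x₀ b
  have hPcard : Nat.card {y // R x₀ y} = P.card := by
    rw [Nat.card_eq_fintype_card, Fintype.card_subtype]
  have hSP : S.card = P.card := by
    rw [← hcard t (fun h => hirr x₀ (h ▸ ht))]
    congr 1
    ext b
    simp only [Finset.mem_image, hS, P, Finset.mem_filter, Finset.mem_univ, true_and]
    constructor
    · rintro ⟨σ, ⟨h1, h2⟩, rfl⟩
      have := hR σ h1 x₀ t
      rw [h2] at this
      exact this.2 ht
    · intro hb
      obtain ⟨σ, h1, h2, h3⟩ := horb b hb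
      exact ⟨σ, ⟨h1, h2⟩, h3⟩
  let Q : Finset N := Finset.univ.filter fun b => b ≠ x₀ ∧ ¬ R x₀ b
  have hsub : ∀ b ∈ Q, (S.image fun σ => σ b) ⊆ Q := by
    intro b hb c hc
    obtain ⟨σ, hσ, rfl⟩ := Finset.mem_image.1 hc
    rw [hS] at hσ
    simp only [Q, Finset.mem_filter, Finset.mem_univ, true_and] at hb ⊢
    have := hR σ hσ.1 x₀ b
    rw [hσ.2] at this
    refine ⟨fun h => hb.1 (σ.injective (h.trans hσ.2.symm)), fun h => hb.2 (this.1 h)⟩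
  have hPQ : P.card + Q.card + 1 ≤ p := by
    have hd : Disjoint P Q := by
      rw [Finset.disjoint_left]
      intro u hu hw
      exact (Finset.mem_filter.1 hw).2.2 (Finset.mem_filter.1 hu).2
    have h0 : x₀ ∉ P ∪ Q := by simp [P, Q, hirr]
    rw [← Finset.card_union_of_disjoint hd, ← Finset.card_insert_of_notMem h0]
    exact (Finset.card_le_univ _).trans hN.le
  by_contra! hno
  have hdis : Disjoint (S.image fun σ => σ y) (S.image fun σ => σ z) := by
    rw [Finset.disjoint_left]
    intro c hc hc'
    obtain ⟨σ, hσ, rfl⟩ := Finset.mem_image.1 hc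
    obtain ⟨τ, hτ, h⟩ := Finset.mem_image.1 hc'
    rw [hS] at hσ hτ
    refine hno (τ⁻¹ * σ) (X.mul_mem (X.inv_mem hτ.1) hσ.1) ?_ ?_
    · simp [Equiv.symm_apply_eq, hσ.2, hτ.2]
    · simpa [Equiv.symm_apply_eq] using h.symm
  have hle := Finset.card_le_card (Finset.union_subset
    (hsub y (by simpa [Q] using ⟨hy, hyR⟩)) (hsub z (by simpa [Q] using ⟨hz, hzR⟩)))
  rw [Finset.card_union_of_disjoint hdis, hcard y hy, hcard z hz] at hle
  omega

end PrimeDegree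

section LocalAction

variable {V : Type*} {Γ : SimpleGraph V}

/-- The permutation group induced on the neighbours of `u` by the stabiliser of `u` in `Aut Γ`. -/
def localGroup (Γ : SimpleGraph V) (u : V) : Subgroup (Equiv.Perm (Γ.neighborSet u)) where
  carrier := {σ | ∃ φ : Γ ≃g Γ, φ u = u ∧ ∀ n : Γ.neighborSet u, φ n = σ n}
  one_mem' := ⟨RelIso.refl _, rfl, fun _ => rfl⟩
  mul_mem' := by
    rintro σ τ ⟨φ, hφ, hσ⟩ ⟨ψ, hψ, hτ⟩
    exact ⟨ψ.trans φ, by simp [hφ, hψ], fun n => by simp [hσ, hτ]⟩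
  inv_mem' := by
    rintro σ ⟨φ, hφ, hσ⟩
    refine ⟨φ.symm, by rw [RelIso.symm_apply_eq, hφ], fun n => ?_⟩
    rw [RelIso.symm_apply_eq, hσ]
    simp

lemma exists_mem_localGroup {u : V} (φ : Γ ≃g Γ) (hφ : φ u = u) :
    ∃ σ ∈ localGroup Γ u, ∀ n : Γ.neighborSet u, φ n = σ n :=
  ⟨Equiv.Perm.subtypePerm φ.toEquiv fun x => by
      change Γ.Adj u (φ x) ↔ Γ.Adj u x
      rw [← φ.map_adj_iff (v := u) (w := x), hφ], ⟨φ, hφ, fun _ => rfl⟩, fun _ => rfl⟩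

end LocalAction

section Counting

variable {V : Type*} {Γ : SimpleGraph V}

lemma Is2Geodesic.map {v u w : V} (h : Is2Geodesic Γ v u w) (φ : Γ ≃g Γ) :
    Is2Geodesic Γ (φ v) (φ u) (φ w) :=
  ⟨φ.map_adj_iff.2 h.1, φ.map_adj_iff.2 h.2.1, φ.injective.ne h.2.2.1,
    fun h' => h.2.2.2 (φ.map_adj_iff.1 h')⟩

lemma Is2Geodesic.symm {v u w : V} (h : Is2Geodesic Γ v u w) : Is2Geodesic Γ w u v :=
  ⟨h.2.1.symm, h.1.symm, h.2.2.1.symm, fun h' => h.2.2.2 h'.symm⟩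

lemma exists_is2Geodesic (hconn : Γ.Connected) (hnc : Γ ≠ ⊤) :
    ∃ v u w, Is2Geodesic Γ v u w := by
  by_contra! hno
  have key : ∀ {a b : V}, Γ.Walk a b → a = b ∨ Γ.Adj a b := by
    intro a b q
    induction q with
    | nil => exact Or.inl rfl
    | @cons a c b h q ih =>
      rcases ih with rfl | h'
      · exact Or.inr h
      · by_cases hab : a = b
        · exact Or.inl hab
        · right
          by_contra hn
          exact hno a c b ⟨h, h', hab, hn⟩
  apply hnc
  ext a b
  obtain ⟨q⟩ := hconn.preconnected a b
  exact ⟨fun h => h.ne, fun h => (key q).resolve_left h⟩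

variable [Fintype V] [DecidableEq V] [DecidableRel Γ.Adj]

/-- The vertices `w` for which `(v,u,w)` is a 2-geodesic. -/
def geodesicEnds (Γ : SimpleGraph V) [DecidableRel Γ.Adj] (v u : V) : Finset V :=
  (Γ.neighborFinset u).filter fun w => v ≠ w ∧ ¬ Γ.Adj v w

lemma mem_geodesicEnds {v u w : V} (h : Γ.Adj v u) :
    w ∈ geodesicEnds Γ v u ↔ Is2Geodesic Γ v u w := by
  simp [geodesicEnds, Is2Geodesic, h]

lemma ArcTransitive.card_geodesicEnds (hΓ : ArcTransitive Γ) {v u v' u' : V} (h : Γ.Adj v u)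
    (h' : Γ.Adj v' u') : (geodesicEnds Γ v u).card = (geodesicEnds Γ v' u').card := by
  have hle : ∀ {v u v' u' : V}, Γ.Adj v u → Γ.Adj v' u' →
      (geodesicEnds Γ v u).card ≤ (geodesicEnds Γ v' u').card := by
    intro v u v' u' h h'
    obtain ⟨φ, rfl, rfl⟩ := hΓ h h'
    refine Finset.card_le_card_of_injOn φ (fun w hw => ?_) φ.injective.injOn
    exact (mem_geodesicEnds h').2 (((mem_geodesicEnds h).1 hw).map φ)
  exact le_antisymm (hle h h') (hle h' h)

/-- The common neighbours of `v` and `w`. -/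
def commonNbrs (Γ : SimpleGraph V) [DecidableRel Γ.Adj] (v w : V) : Finset V :=
  Γ.neighborFinset v ∩ Γ.neighborFinset w

lemma mem_commonNbrs {v w x : V} : x ∈ commonNbrs Γ v w ↔ Γ.Adj v x ∧ Γ.Adj w x := by
  simp [commonNbrs]

lemma TwoGeodesicTransitive.card_commonNbrs (hΓ : TwoGeodesicTransitive Γ) {v u w v' u' w' : V}
    (h : Is2Geodesic Γ v u w) (h' : Is2Geodesic Γ v' u' w') :
    (commonNbrs Γ v w).card = (commonNbrs Γ v' w').card := by
  have hle : ∀ {v u w v' u' w' : V}, Is2Geodesic Γ v u w → Is2Geodesic Γ v' u' w' →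
      (commonNbrs Γ v w).card ≤ (commonNbrs Γ v' w').card := by
    intro v u w v' u' w' h h'
    obtain ⟨φ, rfl, rfl, rfl⟩ := hΓ.2 h h'
    refine Finset.card_le_card_of_injOn φ (fun x hx => ?_) φ.injective.injOn
    have := mem_commonNbrs.1 hx
    exact mem_commonNbrs.2 ⟨φ.map_adj_iff.2 this.1, φ.map_adj_iff.2 this.2⟩
  exact le_antisymm (hle h h') (hle h' h)

variable {p : ℕ}

lemma TwoGeodesicTransitive.card_commonNbrs_dvd (hΓ : TwoGeodesicTransitive Γ)
    (hreg : ∀ v, (Γ.neighborFinset v).card = p) {v u w : V} (h : Is2Geodesic Γ v u w) :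
    (commonNbrs Γ v w).card ∣ p * (geodesicEnds Γ v u).card := by
  classical
  have hcount := Finset.card_mul_eq_card_mul (Is2Geodesic Γ v) (s := Γ.neighborFinset v)
    (t := Finset.univ.filter fun x => ∃ y, Is2Geodesic Γ v y x)
    (m := (geodesicEnds Γ v u).card) (n := (commonNbrs Γ v w).card) ?_ ?_
  · rw [hreg] at hcount
    exact ⟨_, hcount.trans (mul_comm _ _)⟩
  · intro y hy
    have hy' : Γ.Adj v y := by simpa using hy
    rw [hΓ.1.card_geodesicEnds h.1 hy']
    congr 1
    ext x
    rw [mem_geodesicEnds hy', Finset.mem_bipartiteAbove]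
    simpa using fun h => ⟨y, h⟩
  · intro x hx
    obtain ⟨y, hy⟩ := (Finset.mem_filter.1 hx).2
    rw [hΓ.card_commonNbrs h hy]
    congr 1
    ext z
    rw [mem_commonNbrs, Finset.mem_bipartiteBelow, mem_neighborFinset]
    exact ⟨fun h => ⟨h.1, h.2.2.1.symm⟩, fun h => ⟨h.1, h.1, h.2.symm, hy.2.2⟩⟩

lemma ArcTransitive.lt_card_commonNbrs_add (hΓ : ArcTransitive Γ)
    (hreg : ∀ v, (Γ.neighborFinset v).card = p) {v u w : V} (h : Is2Geodesic Γ v u w) :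
    p < (commonNbrs Γ v w).card + 2 * (geodesicEnds Γ v u).card := by
  have hsub : Γ.neighborFinset u ⊆
      ((commonNbrs Γ v w).erase u ∪ geodesicEnds Γ v u) ∪ geodesicEnds Γ w u := by
    intro y hy
    have hy' : Γ.Adj u y := by simpa using hy
    rw [Finset.mem_union, Finset.mem_union, Finset.mem_erase, mem_commonNbrs,
      mem_geodesicEnds h.1, mem_geodesicEnds h.symm.1]
    by_cases hv : Γ.Adj v y
    · by_cases hw : Γ.Adj w y
      · exact Or.inl (Or.inl ⟨hy'.ne', hv, hw⟩)
      · by_cases hwy : w = y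
        · exact absurd (hwy ▸ hv) h.2.2.2
        · exact Or.inr ⟨h.symm.1, hy', hwy, hw⟩
    · by_cases hvy : v = y
      · exact Or.inr (hvy ▸ h.symm)
      · exact Or.inl (Or.inr ⟨h.1, hy', hvy, hv⟩)
  have h1 := (Finset.card_le_card hsub).trans (Finset.card_union_le _ _)
  have h2 := Finset.card_union_le ((commonNbrs Γ v w).erase u) (geodesicEnds Γ v u)
  have hu : u ∈ commonNbrs Γ v w := mem_commonNbrs.2 ⟨h.1, h.2.1.symm⟩
  rw [Finset.card_erase_of_mem hu] at h2
  have h3 := Finset.card_pos.2 ⟨u, hu⟩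
  rw [hreg, hΓ.card_geodesicEnds h.symm.1 h.1] at h1
  omega

lemma TwoGeodesicTransitive.card_commonNbrs_ne (hΓ : TwoGeodesicTransitive Γ) (hp : p.Prime)
    (hreg : ∀ v, (Γ.neighborFinset v).card = p) {v u w : V} (h : Is2Geodesic Γ v u w)
    {a b c : V} (hab : Γ.Adj a b) (hac : Γ.Adj a c) (hbc : Γ.Adj b c) :
    (commonNbrs Γ v w).card ≠ p := by
  intro hc
  have htwin : ∀ {x y z}, Is2Geodesic Γ x y z → ∀ t, Γ.Adj x t ↔ Γ.Adj z t := by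
    intro x y z hxyz t
    have hcard : (commonNbrs Γ x z).card = p := (hΓ.card_commonNbrs hxyz h).trans hc
    have hx : commonNbrs Γ x z = Γ.neighborFinset x :=
      Finset.eq_of_subset_of_card_le Finset.inter_subset_left (by rw [hcard, hreg])
    have hz : commonNbrs Γ x z = Γ.neighborFinset z :=
      Finset.eq_of_subset_of_card_le Finset.inter_subset_right (by rw [hcard, hreg])
    rw [← mem_neighborFinset, ← hx, hz, mem_neighborFinset]
  set f : V → Finset V := fun y => (Γ.neighborFinset a).filter fun z => ¬ Γ.Adj y z with hf
  have hfcard : ∀ y ∈ Γ.neighborFinset a, (f y).card = (geodesicEnds Γ v u).card + 1 := by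
    intro y hy
    have hy' : Γ.Adj a y := by simpa using hy
    rw [hΓ.1.card_geodesicEnds h.1 hy'.symm,
      ← Finset.card_insert_of_notMem (a := y) (by simp [geodesicEnds])]
    congr 1
    ext z
    by_cases hyz : y = z
    · subst hyz
      simp [hf, hy']
    · simp [hf, geodesicEnds, hyz, Ne.symm hyz]
  have hfib : ∀ y ∈ Γ.neighborFinset a, {x ∈ Γ.neighborFinset a | f x = f y} = f y := by
    intro y hy
    have hy' : Γ.Adj a y := by simpa using hy
    ext x
    simp only [Finset.mem_filter]
    constructor
    · rintro ⟨hx, hxy⟩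
      rw [← hxy]
      simpa [hf] using hx
    · intro hx
      obtain ⟨hx, hyx⟩ := Finset.mem_filter.1 hx
      refine ⟨hx, ?_⟩
      by_cases hxy : y = x
      · rw [hxy]
      · have := htwin (x := y) (y := a) (z := x) ⟨hy'.symm, by simpa using hx, hxy, hyx⟩
        simp only [hf, this]
  have hsum := Finset.card_eq_sum_card_image f (Γ.neighborFinset a)
  rw [hreg, Finset.sum_const_nat (m := (geodesicEnds Γ v u).card + 1)] at hsum
  · have hk : 0 < (geodesicEnds Γ v u).card :=
      Finset.card_pos.2 ⟨w, (mem_geodesicEnds h.1).2 h⟩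
    have hkp : (geodesicEnds Γ v u).card + 1 = p :=
      ((Nat.dvd_prime hp).1 ⟨_, hsum.trans (mul_comm _ _)⟩).resolve_left (by omega)
    have hb : b ∈ Γ.neighborFinset a := by simpa using hab
    have hall : f b = Γ.neighborFinset a :=
      Finset.eq_of_subset_of_card_le (Finset.filter_subset _ _)
        (by rw [hreg, hfcard b hb, hkp])
    have hcb : c ∈ f b := by
      rw [hall]
      simpa using hac
    exact (Finset.mem_filter.1 hcb).2 hbc
  · intro s hs
    obtain ⟨y, hy, rfl⟩ := Finset.mem_image.1 hs
    rw [hfib y hy, hfcard y hy]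

/-- In a 2-geodesic transitive graph of prime valency with triangles, at least a third of the
neighbours of `u` prolong an arc `(v,u)` to a 2-geodesic. -/
lemma TwoGeodesicTransitive.le_three_mul_card_geodesicEnds (hΓ : TwoGeodesicTransitive Γ)
    (hp : p.Prime) (hreg : ∀ v, (Γ.neighborFinset v).card = p) {v u w : V}
    (h : Is2Geodesic Γ v u w) {a b c : V} (hab : Γ.Adj a b) (hac : Γ.Adj a c)
    (hbc : Γ.Adj b c) : p ≤ 3 * (geodesicEnds Γ v u).card := by
  have hne := hΓ.card_commonNbrs_ne hp hreg h hab hac hbc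
  have hle : (commonNbrs Γ v w).card ≤ p :=
    (Finset.card_le_card Finset.inter_subset_left).trans (hreg v).le
  have hpos : 0 < (commonNbrs Γ v w).card :=
    Finset.card_pos.2 ⟨u, mem_commonNbrs.2 ⟨h.1, h.2.1.symm⟩⟩
  have hk : 0 < (geodesicEnds Γ v u).card :=
    Finset.card_pos.2 ⟨w, (mem_geodesicEnds h.1).2 h⟩
  have hcop : ((commonNbrs Γ v w).card).Coprime p :=
    (Nat.coprime_of_lt_prime hpos.ne' (lt_of_le_of_ne hle hne) hp).symm
  have hdvd := hcop.dvd_of_dvd_mul_left (hΓ.card_commonNbrs_dvd hreg h)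
  have h1 := Nat.le_of_dvd hk hdvd
  have h2 := hΓ.1.lt_card_commonNbrs_add hreg h
  omega

end Counting

theorem stmt4 {V : Type*} [Fintype V] (Γ : SimpleGraph V) (p : ℕ)
    (hp : p.Prime)
    (hreg : ∀ v : V, Nat.card (Γ.neighborSet v) = p)
    (hconn : Γ.Connected)
    (hnc : Γ ≠ ⊤)
    (h2gt : TwoGeodesicTransitive Γ)
    (h2at : ¬ TwoArcTransitive Γ) :
    ∀ v u : V, Γ.Adj v u →
      ∀ w w' : V, (Γ.Adj v w ∧ Γ.Adj u w) → (Γ.Adj v w' ∧ Γ.Adj u w') →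
        ∃ φ : Γ ≃g Γ, φ v = v ∧ φ u = u ∧ φ w = w' := by
  classical
  intro v u hvu w w' hw hw'
  have : Fact p.Prime := ⟨hp⟩
  have hreg' : ∀ x, (Γ.neighborFinset x).card = p := fun x => by
    rw [← hreg x, Nat.card_eq_fintype_card, SimpleGraph.card_neighborSet_eq_degree,
      SimpleGraph.card_neighborFinset_eq_degree]
  obtain ⟨t, ht⟩ : ∃ t, Is2Geodesic Γ v u t := by
    obtain ⟨a, b, c, habc⟩ := exists_is2Geodesic hconn hnc
    obtain ⟨φ, rfl, rfl⟩ := h2gt.1 habc.1 hvu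
    exact ⟨_, habc.map φ⟩
  have hk := h2gt.le_three_mul_card_geodesicEnds hp hreg' ht hvu hw.1 hw.2
  let R : Γ.neighborSet u → Γ.neighborSet u → Prop := fun x y =>
    Is2Geodesic Γ (x : V) u (y : V)
  have hcard : Nat.card {y // R ⟨v, hvu.symm⟩ y} = (geodesicEnds Γ v u).card := by
    rw [← Nat.card_eq_finsetCard]
    refine Nat.card_congr
      { toFun := fun y => ⟨y.1.1, (mem_geodesicEnds hvu).2 y.2⟩
        invFun := fun y => ⟨⟨y.1, ((mem_geodesicEnds hvu).1 y.2).2.1⟩,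
          (mem_geodesicEnds hvu).1 y.2⟩
        left_inv := fun _ => rfl
        right_inv := fun _ => rfl }
  have htrans : ∀ x y, ∃ σ ∈ localGroup Γ u, σ x = y := by
    rintro ⟨x, hx⟩ ⟨y, hy⟩
    obtain ⟨φ, hu, hxy⟩ := h2gt.1 hx hy
    obtain ⟨σ, hσ, h⟩ := exists_mem_localGroup φ hu
    exact ⟨σ, hσ, Subtype.ext ((h _).symm.trans hxy)⟩
  have hR : ∀ σ ∈ localGroup Γ u, ∀ x y, R (σ x) (σ y) ↔ R x y := by
    rintro σ ⟨φ, hu, h⟩ x y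
    change Is2Geodesic Γ (σ x : V) u (σ y : V) ↔ Is2Geodesic Γ (x : V) u (y : V)
    rw [← h, ← h]
    refine ⟨fun hxy => ?_, fun hxy => by simpa [hu] using hxy.map φ⟩
    have hu' : φ.symm u = u := by rw [RelIso.symm_apply_eq, hu]
    simpa [hu'] using hxy.map φ.symm
  have horb : ∀ y, R ⟨v, hvu.symm⟩ y →
      ∃ σ ∈ localGroup Γ u, σ ⟨v, hvu.symm⟩ = ⟨v, hvu.symm⟩ ∧ σ ⟨t, ht.2.1⟩ = y := by
    rintro ⟨y, hy⟩ hvy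
    obtain ⟨φ, hv, hu, hty⟩ := h2gt.2 ht hvy
    obtain ⟨σ, hσ, h⟩ := exists_mem_localGroup φ hu
    exact ⟨σ, hσ, Subtype.ext ((h _).symm.trans hv), Subtype.ext ((h _).symm.trans hty)⟩
  obtain ⟨σ, ⟨φ, hφ, hσ⟩, hv, hww⟩ := exists_fixing_map_eq
    ((Nat.card_eq_fintype_card).symm.trans (hreg u)) htrans hR (fun x h => h.2.2.1 rfl) ht horb
    (hcard ▸ hk) (y := ⟨w, hw.2⟩) (z := ⟨w', hw'.2⟩)
    (fun h => hw.1.ne (congrArg Subtype.val h).symm) (fun h => h.2.2.2 hw.1)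
    (fun h => hw'.1.ne (congrArg Subtype.val h).symm) (fun h => h.2.2.2 hw'.1)
  exact ⟨φ, by simpa [hv] using hσ ⟨v, hvu.symm⟩, hφ, by simpa [hww] using hσ ⟨w, hw.2⟩⟩
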